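/- Let δ ∈ (0,1] be a constant, let I = (V,E,λ) and I' = (V,E',λ) be hardcore instances on the same vertex set with n = |V|, |E ⊕ E'| ≤ L, λ ≤ (2−δ)/(Δ_G−2) where Δ_G ≥ 3 is the maximum degree of G = (V,E), and Ω_{I'} ⊆ Ω_I. Let Δ = max{Δ_G, Δ_{G'}} with Δ_{G'} the maximum degree of G' = (V,E'). Let ρ: Ω_I × Ω_I → ℝ_{≥0} be any function satisfying: (a) every one-step optimal coupling of the Gibbs sampling chain on I satisfies E[ρ(X_t,Y_t) | X_{t−1} = σ ∧ Y_{t−1} = τ] ≤ (1 − (δ/96)/n)·ρ(σ,τ) for all σ, τ ∈ Ω_I; and (b) ρ is 12Δ_G-Lipschitz with respect to the Hamming distance on pairs, i.e., |ρ(σ,τ) − ρ(σ',τ')| ≤ 12Δ_G·H(στ, σ'τ') for all σ,σ',τ,τ' ∈ Ω_I. Then the one-step local coupling for edge update between the Gibbs sampling chains on I and I' satisfies, for all σ ∈ Ω_I and τ ∈ Ω_{I'}, E[ρ(X_t,Y_t) | X_{t−1} = σ ∧ Y_{t−1} = τ] ≤ (1 − (δ/96)/n)·ρ(σ,τ) +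 48·Δ·L/n. -/

import Mathlib

open Finset
open scoped ENNReal

/-- Exponential on `ℝ ∪ {−∞}` (modeled as `WithBot ℝ`), with `exp(−∞) = 0`. -/
noncomputable def expB (x : WithBot ℝ) : ℝ := WithBot.recBotCoe 0 Real.exp x

/-- Total variation distance between two distributions on a finite set. -/
noncomputable def tvDist {Q : Type*} [Fintype Q] (μ ν : Q → ℝ) : ℝ :=
  2⁻¹ * ∑ x, |μ x - ν x|

/-- `D` is a coupling of the distributions `μ` and `ν` on a finite set. -/
def IsCoupling {Q : Type*} [Fintype Q] (μ ν : Q → ℝ) (D : Q → Q → ℝ) : Prop :=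
  (∀ c c', 0 ≤ D c c') ∧ (∀ c, ∑ c', D c c' = μ c) ∧ (∀ c', ∑ c, D c c' = ν c')

/-- `D` is an optimal coupling of `μ` and `ν`: a coupling maximizing the probability
of agreement of the two coordinates. -/
def IsOptimalCoupling {Q : Type*} [Fintype Q] (μ ν : Q → ℝ) (D : Q → Q → ℝ) : Prop :=
  IsCoupling μ ν D ∧
    ∀ D' : Q → Q → ℝ, IsCoupling μ ν D' → ∑ c, D' c c ≤ ∑ c, D c c

/-- Distribution of a finite-state Markov chain with transition kernel `P` after `t` steps,
started from the initial distribution `init`. -/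
noncomputable def chainDist {S : Type*} [Fintype S] (P : S → S → ℝ) (init : S → ℝ) :
    ℕ → S → ℝ
  | 0 => init
  | t + 1 => fun s' => ∑ s, chainDist P init t s * P s s'

/-- Point mass at `s0`. -/
noncomputable def initDelta {S : Type*} [DecidableEq S] (s0 : S) : S → ℝ :=
  fun s => if s = s0 then 1 else 0

/-- Transition kernel of a coupled pair of single-site (Gibbs-sampling style) chains:
a uniformly random vertex `v` is picked, all other coordinates of both copies are copied,
and the pair of new values at `v` is drawn from the local coupling `Dloc v`. -/
noncomputable def pairKernel {V Q : Type*} [Fintype V] [Fintype Q]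
    (Dloc : V → (V → Q) → (V → Q) → Q → Q → ℝ)
    (p p' : (V → Q) × (V → Q)) : ℝ := by
  classical
  exact (Fintype.card V : ℝ)⁻¹ * ∑ v,
    (if (∀ u, u ≠ v → p'.1 u = p.1 u) ∧ (∀ u, u ≠ v → p'.2 u = p.2 u)
      then Dloc v p.1 p.2 (p'.1 v) (p'.2 v) else 0)

/-- The resampling probability `p(c)` used in the local coupling for Hamiltonian update. -/
noncomputable def pResample {Q : Type*} (μ μ' : Q → ℝ) (c : Q) : ℝ := by
  classical
  exact if μ c ≤ μ' c then 0 else (μ c - μ' c) / μ c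

/-- The resampling distribution `ν` used in the local coupling for Hamiltonian update. -/
noncomputable def nuResample {Q : Type*} [Fintype Q] (μ μ' : Q → ℝ) (b : Q) : ℝ :=
  max 0 (μ' b - μ b) / ∑ x, max 0 (μ x - μ' x)

/-- The joint law of the local coupling for Hamiltonian update: first `(c,c')` is drawn from
the optimal coupling `Dopt`, then with probability `pResample μ μ' c'` the second coordinate
is resampled from `nuResample μ μ'`. -/
noncomputable def hamCoupling {Q : Type*} [Fintype Q] (μ μ' : Q → ℝ)
    (Dopt : Q → Q → ℝ) (c d : Q) : ℝ :=
  Dopt c d * (1 - pResample μ μ' d) +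
    nuResample μ μ' d * ∑ c', Dopt c c' * pResample μ μ' c'

/-- Indicator (as a real number) of the event `v ∈ Γ⁺(D)`, where `D` is the set of
disagreements between the two coordinates of the pair state `p`. -/
noncomputable def indNbr {V Q : Type*} [Fintype V] (G : SimpleGraph V)
    (p : (V → Q) × (V → Q)) (v : V) : ℝ := by
  classical
  exact if (∃ u, (u = v ∨ G.Adj v u) ∧ p.1 u ≠ p.2 u) then 1 else 0

/-- `v` is incident to an edge of the symmetric difference of the edge sets of `G` and `G'`. -/
def inS {V : Type*} (G G' : SimpleGraph V) (v : V) : Prop :=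
  ∃ u, (G.Adj v u ∧ ¬ G'.Adj v u) ∨ (G'.Adj v u ∧ ¬ G.Adj v u)

/-- Indicator (as a real number) of the event `v ∈ S ∪ Γ_G⁺(D)`. -/
noncomputable def indSnbr {V Q : Type*} [Fintype V] (G G' : SimpleGraph V)
    (p : (V → Q) × (V → Q)) (v : V) : ℝ := by
  classical
  exact if inS G G' v ∨ (∃ u, (u = v ∨ G.Adj v u) ∧ p.1 u ≠ p.2 u) then 1 else 0

/-- A configuration `σ : V → Bool` is feasible for the hardcore model on `G`
(its support is an independent set). -/
def IsIndep {V : Type*} (G : SimpleGraph V) (σ : V → Bool) : Prop :=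
  ∀ u v, G.Adj u v → ¬(σ u = true ∧ σ v = true)

/-- Conditional marginal distribution at `v` of the hardcore model on `G` with fugacity `lam`,
given the configuration `τ` on the neighborhood of `v`. -/
noncomputable def margHC {V : Type*} [Fintype V] (G : SimpleGraph V) [DecidableRel G.Adj]
    (lam : ℝ) (v : V) (τ : V → Bool) (b : Bool) : ℝ := by
  classical
  exact (if b then (if ∀ u ∈ G.neighborFinset v, τ u = false then lam else 0) else 1) /
    (1 + (if ∀ u ∈ G.neighborFinset v, τ u = false then lam else 0))

/-- Unnormalized hardcore weight `λ^{‖σ‖}` of a feasible configuration (and `0` otherwise). -/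
noncomputable def hcWeight {V : Type*} [Fintype V] (G : SimpleGraph V)
    (lam : ℝ) (σ : V → Bool) : ℝ := by
  classical
  exact if IsIndep G σ then lam ^ (Finset.univ.filter fun v => σ v = true).card else 0

/-- The hardcore Gibbs distribution `μ_I(σ) ∝ λ^{‖σ‖}` on independent-set configurations. -/
noncomputable def hcGibbs {V : Type*} [Fintype V] [DecidableEq V] (G : SimpleGraph V)
    (lam : ℝ) (σ : V → Bool) : ℝ :=
  hcWeight G lam σ / ∑ σ' : V → Bool, hcWeight G lam σ'

/-- Transition kernel of the Gibbs sampling chain of the hardcore model. -/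
noncomputable def gibbsStepHC {V : Type*} [Fintype V] (G : SimpleGraph V) [DecidableRel G.Adj]
    (lam : ℝ) (σ σ' : V → Bool) : ℝ := by
  classical
  exact (Fintype.card V : ℝ)⁻¹ *
    ∑ v, (if ∀ u, u ≠ v → σ' u = σ u then margHC G lam v σ (σ' v) else 0)

/-- The maximal coupling of two distributions on `Bool`. -/
noncomputable def boolCoupling (μ ν : Bool → ℝ) (b b' : Bool) : ℝ :=
  if b = b' then min (μ b) (ν b) else max 0 (μ b - ν b)

theorem isOptimalCoupling_boolCoupling {μ ν : Bool → ℝ} (hμ : ∀ b, 0 ≤ μ b) (hν : ∀ b, 0 ≤ ν b)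
    (hμ1 : ∑ b, μ b = 1) (hν1 : ∑ b, ν b = 1) :
    IsOptimalCoupling μ ν (boolCoupling μ ν) := by
  simp only [Fintype.sum_bool] at hμ1 hν1
  refine ⟨⟨?_, ?_, ?_⟩, ?_⟩
  · intro c c'
    unfold boolCoupling
    split_ifs
    · exact le_min (hμ c) (hν c)
    · exact le_max_left _ _
  · intro c
    cases c <;> simp [boolCoupling] <;> grind
  · intro c
    cases c <;> simp [boolCoupling] <;> grind
  · rintro D ⟨h0, h1, h2⟩
    refine Finset.sum_le_sum fun c _ => ?_
    simp only [boolCoupling, if_true]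
    refine le_min ?_ ?_
    · rw [← h1 c]
      exact Finset.single_le_sum (fun c' _ => h0 c c') (Finset.mem_univ c)
    · rw [← h2 c]
      exact Finset.single_le_sum (f := fun c' => D c' c) (fun c' _ => h0 c' c) (Finset.mem_univ c)

theorem isCoupling_mul {Q : Type*} [Fintype Q] {μ ν : Q → ℝ} (hμ : ∀ b, 0 ≤ μ b)
    (hν : ∀ b, 0 ≤ ν b) (hμ1 : ∑ b, μ b = 1) (hν1 : ∑ b, ν b = 1) :
    IsCoupling μ ν fun b b' => μ b * ν b' :=
  ⟨fun c c' => mul_nonneg (hμ c) (hν c'), fun c => by rw [← Finset.mul_sum, hν1, mul_one],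
    fun c => by rw [← Finset.sum_mul, hμ1, one_mul]⟩

theorem IsCoupling.left_ne_zero {Q : Type*} [Fintype Q] {μ ν : Q → ℝ} {D : Q → Q → ℝ}
    (h : IsCoupling μ ν D) {c c' : Q} (hD : D c c' ≠ 0) : μ c ≠ 0 := by
  have h1 : D c c' ≤ μ c := by
    rw [← h.2.1 c]
    exact Finset.single_le_sum (fun c' _ => h.1 c c') (Finset.mem_univ c')
  exact (((h.1 c c').lt_of_ne' hD).trans_le h1).ne'

theorem IsCoupling.right_ne_zero {Q : Type*} [Fintype Q] {μ ν : Q → ℝ} {D : Q → Q → ℝ}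
    (h : IsCoupling μ ν D) {c c' : Q} (hD : D c c' ≠ 0) : ν c' ≠ 0 := by
  have h1 : D c c' ≤ ν c' := by
    rw [← h.2.2 c']
    exact Finset.single_le_sum (f := fun c => D c c') (fun c _ => h.1 c c') (Finset.mem_univ c)
  exact (((h.1 c c').lt_of_ne' hD).trans_le h1).ne'

/-- If any two values of `f` on the supports of two distributions differ by at most `C`, then so
do the two expectations of `f`. -/
theorem sum_mul_le_sum_mul_add {A : Type*} [Fintype A] {p q f : A → ℝ} {C : ℝ}
    (hp : ∀ a, 0 ≤ p a) (hq : ∀ a, 0 ≤ q a) (hp1 : ∑ a, p a = 1) (hq1 : ∑ a, q a = 1)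
    (hf : ∀ a b, p a ≠ 0 → q b ≠ 0 → f a ≤ f b + C) :
    ∑ a, p a * f a ≤ ∑ a, q a * f a + C := by
  have hle : ∑ a, ∑ b, p a * q b * f a ≤ ∑ a, ∑ b, p a * q b * (f b + C) := by
    refine Finset.sum_le_sum fun a _ => Finset.sum_le_sum fun b _ => ?_
    by_cases ha : p a = 0
    · simp [ha]
    by_cases hb : q b = 0
    · simp [hb]
    exact mul_le_mul_of_nonneg_left (hf a b ha hb) (mul_nonneg (hp a) (hq b))
  have hl : ∑ a, ∑ b, p a * q b * f a = ∑ a, p a * f a := by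
    refine Finset.sum_congr rfl fun a _ => ?_
    rw [← Finset.sum_mul, ← Finset.mul_sum, hq1, mul_one]
  have hr : ∑ a, ∑ b, p a * q b * (f b + C) = ∑ a, q a * f a + C := by
    simp only [mul_assoc, ← Finset.mul_sum]
    rw [← Finset.sum_mul, hp1, one_mul]
    simp only [mul_add, Finset.sum_add_distrib]
    rw [← Finset.sum_mul, hq1, one_mul]
  rwa [hl, hr] at hle

theorem IsCoupling.expectation_le_add {Q : Type*} [Fintype Q] {μ ν μ' ν' : Q → ℝ}
    {D D' : Q → Q → ℝ} (h : IsCoupling μ ν D) (h' : IsCoupling μ' ν' D')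
    (hμ : ∑ b, μ b = 1) (hμ' : ∑ b, μ' b = 1) {f : Q → Q → ℝ} {C : ℝ}
    (hf : ∀ a b c d, μ a ≠ 0 → ν b ≠ 0 → μ' c ≠ 0 → ν' d ≠ 0 → f a b ≤ f c d + C) :
    ∑ a, ∑ b, D a b * f a b ≤ ∑ a, ∑ b, D' a b * f a b + C := by
  have key := sum_mul_le_sum_mul_add (A := Q × Q) (p := fun x => D x.1 x.2)
    (q := fun x => D' x.1 x.2) (f := fun x => f x.1 x.2) (C := C)
    (fun x => h.1 _ _) (fun x => h'.1 _ _)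
    (by simp only [Fintype.sum_prod_type, h.2.1, hμ])
    (by simp only [Fintype.sum_prod_type, h'.2.1, hμ'])
    (fun x y hx hy => hf _ _ _ _ (h.left_ne_zero hx) (h.right_ne_zero hx)
      (h'.left_ne_zero hy) (h'.right_ne_zero hy))
  simpa only [Fintype.sum_prod_type] using key

section HardCore

variable {V : Type*} [Fintype V]

theorem margHC_nonneg (G : SimpleGraph V) [DecidableRel G.Adj] {lam : ℝ} (hlam : 0 < lam) (v : V)
    (τ : V → Bool) (b : Bool) : 0 ≤ margHC G lam v τ b := by
  unfold margHC
  split_ifs <;> positivity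

theorem sum_margHC (G : SimpleGraph V) [DecidableRel G.Adj] {lam : ℝ} (hlam : 0 < lam) (v : V)
    (τ : V → Bool) : ∑ b, margHC G lam v τ b = 1 := by
  simp only [margHC, Fintype.sum_bool, if_true, Bool.false_eq_true, if_false]
  rw [← add_div, add_comm]
  refine div_self ?_
  split_ifs <;> positivity

theorem IsIndep.update [DecidableEq V] {G : SimpleGraph V} [DecidableRel G.Adj] {lam : ℝ}
    {σ : V → Bool} (hσ : IsIndep G σ) {v : V} {b : Bool} (hb : margHC G lam v σ b ≠ 0) :
    IsIndep G (Function.update σ v b) := by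
  have hnbr : b = true → ∀ u, G.Adj v u → σ u = false := by
    rintro rfl
    by_contra! hne
    obtain ⟨u, hu, hσu⟩ := hne
    refine hb ?_
    have : ¬ ∀ u ∈ G.neighborFinset v, σ u = false := fun h =>
      hσu (h u (by simpa using hu))
    simp only [margHC, if_neg this, if_true, zero_div]
  intro x y hxy
  have hne := hxy.ne
  rintro ⟨hx, hy⟩
  by_cases hxv : x = v
  · subst hxv
    rw [Function.update_self] at hx
    rw [Function.update_of_ne hne.symm, hnbr hx y hxy] at hy
    simp at hy
  · rw [Function.update_of_ne hxv] at hx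
    by_cases hyv : y = v
    · subst hyv
      rw [Function.update_self] at hy
      rw [hnbr hy x hxy.symm] at hx
      simp at hx
    · rw [Function.update_of_ne hyv] at hy
      exact hσ x y hxy ⟨hx, hy⟩

theorem hammingDist_update_update_le_one [DecidableEq V] {Q : Type*} [DecidableEq Q]
    (σ : V → Q) (v : V) (b c : Q) :
    hammingDist (Function.update σ v b) (Function.update σ v c) ≤ 1 := by
  rw [hammingDist, ← Finset.card_singleton v]
  refine Finset.card_le_card fun u hu => ?_
  by_contra huv
  simp only [Finset.mem_singleton] at huv
  simp [Function.update_of_ne huv] at hu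

open Classical in
/-- At most two vertices per edge of the symmetric difference are affected by an edge update. -/
theorem card_filter_inS_le (G G' : SimpleGraph V) [DecidableEq V]
    [Fintype G.edgeSet] [Fintype G'.edgeSet] :
    (Finset.univ.filter (inS G G')).card ≤ 2 * (symmDiff G.edgeFinset G'.edgeFinset).card := by
  have hsub : Finset.univ.filter (inS G G') ⊆
      (symmDiff G.edgeFinset G'.edgeFinset).biUnion Sym2.toFinset := by
    intro v hv
    obtain ⟨u, hu⟩ := (Finset.mem_filter.1 hv).2
    refine Finset.mem_biUnion.2 ⟨s(v, u), ?_, by simp⟩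
    simpa [Finset.mem_symmDiff] using hu
  refine (Finset.card_le_card hsub).trans ?_
  rw [mul_comm]
  refine Finset.card_biUnion_le_card_mul _ _ _ fun e _ => ?_
  rw [Sym2.card_toFinset]
  split_ifs <;> simp

end HardCore

/-- Hardcore edge update with a potential function. Let `I = (V,E,λ)` and
`I' = (V,E',λ)` with `|E ⊕ E'| ≤ L`, `λ ≤ (2−δ)/(Δ_G−2)`, `Δ_G ≥ 3`, `Ω_{I'} ⊆ Ω_I`, and
`Δ = max{Δ_G, Δ_{G'}}`. If `ρ : Ω_I × Ω_I → ℝ_{≥0}` satisfies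
(a) step-wise decay `E[ρ(X_t,Y_t)|X_{t−1}=σ ∧ Y_{t−1}=τ] ≤ (1 − (δ/96)/n)·ρ(σ,τ)` under
every one-step optimal coupling of the Gibbs chain on `I`, and (b) `ρ` is `12Δ_G`-Lipschitz
with respect to the Hamming distance on pairs, then the one-step local coupling for edge
update satisfies, for all `σ ∈ Ω_I` and `τ ∈ Ω_{I'}`,
`E[ρ(X_t,Y_t) | X_{t−1}=σ ∧ Y_{t−1}=τ] ≤ (1 − (δ/96)/n)·ρ(σ,τ) + 48·Δ·L/n`. -/
theorem hardcore_edge_update_rho_contraction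
    {V : Type*} [Fintype V] [DecidableEq V] [Nonempty V]
    (G G' : SimpleGraph V) [DecidableRel G.Adj] [DecidableRel G'.Adj]
    [Fintype G.edgeSet] [Fintype G'.edgeSet]
    (δ lam L : ℝ) (hδ0 : 0 < δ) (hδ1 : δ ≤ 1) (hlam0 : 0 < lam)
    (hΔG : 3 ≤ G.maxDegree)
    (hlam : lam ≤ (2 - δ) / ((G.maxDegree : ℝ) - 2))
    (hL : ((symmDiff G.edgeFinset G'.edgeFinset).card : ℝ) ≤ L)
    (hΩ : ∀ σ : V → Bool, IsIndep G' σ → IsIndep G σ)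
    (ρ : (V → Bool) → (V → Bool) → ℝ)
    (hρ0 : ∀ σ τ : V → Bool, IsIndep G σ → IsIndep G τ → 0 ≤ ρ σ τ)
    -- (a) step-wise decay under every one-step optimal coupling of the Gibbs chain on I
    (hdecay : ∀ Dopt : V → (V → Bool) → (V → Bool) → Bool → Bool → ℝ,
      (∀ (v : V) (σ τ : V → Bool),
        IsOptimalCoupling (margHC G lam v σ) (margHC G lam v τ) (Dopt v σ τ)) →
      ∀ σ τ : V → Bool, IsIndep G σ → IsIndep G τ →
        (Fintype.card V : ℝ)⁻¹ * ∑ v, ∑ b, ∑ b',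
            Dopt v σ τ b b' * ρ (Function.update σ v b) (Function.update τ v b')
          ≤ (1 - (δ / 96) / (Fintype.card V : ℝ)) * ρ σ τ)
    -- (b) Lipschitz
    (hlip : ∀ σ σ' τ τ' : V → Bool,
      IsIndep G σ → IsIndep G σ' → IsIndep G τ → IsIndep G τ' →
      |ρ σ τ - ρ σ' τ'| ≤
        12 * (G.maxDegree : ℝ) * ((hammingDist σ σ' : ℝ) + (hammingDist τ τ' : ℝ)))
    -- the one-step local coupling for edge update
    (Dloc : V → (V → Bool) → (V → Bool) → Bool → Bool → ℝ)
    (hS : ∀ (v : V) (σ τ : V → Bool), inS G G' v →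
      ∀ b b', Dloc v σ τ b b' = margHC G lam v σ b * margHC G' lam v τ b')
    (hOpt : ∀ (v : V) (σ τ : V → Bool), ¬ inS G G' v →
      IsOptimalCoupling (margHC G lam v σ) (margHC G lam v τ) (Dloc v σ τ)) :
    ∀ σ τ : V → Bool, IsIndep G σ → IsIndep G' τ →
      (Fintype.card V : ℝ)⁻¹ * ∑ v, ∑ b, ∑ b',
          Dloc v σ τ b b' * ρ (Function.update σ v b) (Function.update τ v b')
        ≤ (1 - (δ / 96) / (Fintype.card V : ℝ)) * ρ σ τ +
            48 * (max G.maxDegree G'.maxDegree : ℝ) * L / (Fintype.card V : ℝ) := by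
  classical
  intro σ τ hσ hτ'
  have hτ := hΩ τ hτ'
  set n : ℝ := (Fintype.card V : ℝ) with hn
  have hn0 : 0 < n := by
    rw [hn]
    exact_mod_cast Fintype.card_pos
  set d : ℝ := (G.maxDegree : ℝ) with hd
  have hd0 : 0 ≤ d := Nat.cast_nonneg _
  let Dopt : V → (V → Bool) → (V → Bool) → Bool → Bool → ℝ := fun v σ τ =>
    if inS G G' v then boolCoupling (margHC G lam v σ) (margHC G lam v τ) else Dloc v σ τ
  have hDopt : ∀ (v : V) (σ τ : V → Bool),
      IsOptimalCoupling (margHC G lam v σ) (margHC G lam v τ) (Dopt v σ τ) := by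
    intro v σ τ
    by_cases hv : inS G G' v
    · simp only [Dopt, if_pos hv]
      exact isOptimalCoupling_boolCoupling (margHC_nonneg G hlam0 v σ) (margHC_nonneg G hlam0 v τ)
        (sum_margHC G hlam0 v σ) (sum_margHC G hlam0 v τ)
    · simp only [Dopt, if_neg hv]
      exact hOpt v σ τ hv
  have hstep : ∀ v, ∑ b, ∑ b',
      Dloc v σ τ b b' * ρ (Function.update σ v b) (Function.update τ v b') ≤
      ∑ b, ∑ b', Dopt v σ τ b b' * ρ (Function.update σ v b) (Function.update τ v b') +
        if inS G G' v then 24 * d else 0 := by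
    intro v
    by_cases hv : inS G G' v
    · rw [if_pos hv]
      have hloc : IsCoupling (margHC G lam v σ) (margHC G' lam v τ) (Dloc v σ τ) := by
        rw [show Dloc v σ τ = fun b b' => margHC G lam v σ b * margHC G' lam v τ b' from
          funext₂ (hS v σ τ hv)]
        exact isCoupling_mul (margHC_nonneg G hlam0 v σ) (margHC_nonneg G' hlam0 v τ)
          (sum_margHC G hlam0 v σ) (sum_margHC G' hlam0 v τ)
      refine hloc.expectation_le_add (hDopt v σ τ).1 (sum_margHC G hlam0 v σ)
        (sum_margHC G hlam0 v σ) fun a b a' b' ha hb ha' hb' => ?_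
      have hρ := (abs_le.1 (hlip _ _ _ _ (hσ.update ha) (hσ.update ha') (hΩ _ (hτ'.update hb))
        (hτ.update hb'))).2
      have h1 : (hammingDist (Function.update σ v a) (Function.update σ v a') : ℝ) ≤ 1 := by
        exact_mod_cast hammingDist_update_update_le_one σ v a a'
      have h2 : (hammingDist (Function.update τ v b) (Function.update τ v b') : ℝ) ≤ 1 := by
        exact_mod_cast hammingDist_update_update_le_one τ v b b'
      nlinarith
    · simp [Dopt, hv]
  have hcard : ((Finset.univ.filter (inS G G')).card : ℝ) ≤ 2 * L := by
    have h : ((Finset.univ.filter (inS G G')).card : ℝ) ≤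
        2 * ((symmDiff G.edgeFinset G'.edgeFinset).card : ℝ) := by
      exact_mod_cast card_filter_inS_le G G'
    linarith
  have hL0 : 0 ≤ L := (Nat.cast_nonneg _).trans hL
  have herr : ∑ v, (if inS G G' v then 24 * d else 0) ≤ 48 * max d (G'.maxDegree : ℝ) * L := by
    rw [← Finset.sum_filter, Finset.sum_const, nsmul_eq_mul]
    calc _ ≤ 2 * L * (24 * d) := by gcongr
      _ = 48 * d * L := by ring
      _ ≤ _ := by gcongr; exact le_max_left _ _
  calc _ ≤ n⁻¹ * (∑ v, ∑ b, ∑ b',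
          Dopt v σ τ b b' * ρ (Function.update σ v b) (Function.update τ v b') +
          48 * max d (G'.maxDegree : ℝ) * L) := by
        gcongr
        refine (Finset.sum_le_sum fun v _ => hstep v).trans ?_
        rw [Finset.sum_add_distrib]
        gcongr
    _ ≤ _ := by
        rw [mul_add, div_eq_inv_mul (48 * max d (G'.maxDegree : ℝ) * L) n]
        exact add_le_add_left (hdecay Dopt hDopt σ τ hσ hτ) _
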